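/- arXiv:2505.14083 — 8 statements merged into one kernel-verified Lean document; each statement's English description precedes it below -/
import Mathlib

section
/- Let λ > 0, γ ≥ 1 and 1 < β < ∞, and let (σ_i)_{i≥1} be a sequence of nonnegative real numbers such that σ_i ≤ γ·i^{−β} for every integer i ≥ 1. Then the series ∑_{i=1}^∞ σ_i/(σ_i + λ) converges and ∑_{i=1}^∞ σ_i/(σ_i + λ) ≤ γ·(β/(β−1))·λ^{−1/β}. -/
open MeasureTheory in
/-- The function `x ↦ (min 1 (a / x)) ^ β`, in the form `a ^ β * max x a ^ (-β)`, has integral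
`β / (β - 1) * a` over the positive half-line. -/
theorem integral_Ioi_zero_truncated_rpow {a β : ℝ} (ha : 0 < a) (hβ : 1 < β) :
    IntegrableOn (fun x : ℝ => a ^ β * max x a ^ (-β)) (Set.Ioi 0) ∧
      ∫ x in Set.Ioi (0 : ℝ), a ^ β * max x a ^ (-β) = β / (β - 1) * a := by
  have h_left : Set.EqOn (fun x : ℝ => a ^ β * max x a ^ (-β)) (fun _ => 1) (Set.Ioc 0 a) := by
    intro x hx
    simp only [max_eq_right hx.2]
    rw [← Real.rpow_add ha, add_neg_cancel, Real.rpow_zero]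
  have h_right : Set.EqOn (fun x : ℝ => a ^ β * max x a ^ (-β)) (fun x => a ^ β * x ^ (-β))
      (Set.Ioi a) := by
    intro x hx
    simp only [max_eq_left (le_of_lt (Set.mem_Ioi.mp hx))]
  have hint_left : IntegrableOn (fun x : ℝ => a ^ β * max x a ^ (-β)) (Set.Ioc 0 a) :=
    IntegrableOn.congr_fun (integrableOn_const (by simp)) h_left.symm measurableSet_Ioc
  have hint_right : IntegrableOn (fun x : ℝ => a ^ β * max x a ^ (-β)) (Set.Ioi a) :=
    IntegrableOn.congr_fun
      ((integrableOn_Ioi_rpow_of_lt (by linarith : -β < -1) ha).const_mul (a ^ β))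
      h_right.symm measurableSet_Ioi
  rw [← Set.Ioc_union_Ioi_eq_Ioi ha.le]
  refine ⟨hint_left.union hint_right, ?_⟩
  rw [setIntegral_union (Set.Ioc_disjoint_Ioi le_rfl) measurableSet_Ioi hint_left hint_right,
    setIntegral_congr_fun measurableSet_Ioc h_left, setIntegral_congr_fun measurableSet_Ioi h_right,
    integral_const_mul, integral_Ioi_rpow_of_lt (by linarith) ha]
  have h_pow : a ^ β * a ^ (-β + 1) = a := by
    rw [← Real.rpow_add ha]
    simp
  have h1 : β - 1 ≠ 0 := by linarith
  have h2 : -β + 1 ≠ 0 := by linarith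
  rw [mul_div_assoc', mul_neg, h_pow]
  simp only [setIntegral_const, measureReal_def, Real.volume_Ioc, sub_zero,
    ENNReal.toReal_ofReal ha.le, smul_eq_mul, mul_one]
  field_simp
  ring

theorem antitone_truncated_rpow {a β : ℝ} (ha : 0 < a) (hβ : 0 ≤ β) :
    Antitone (fun x : ℝ => a ^ β * max x a ^ (-β)) := by
  intro x y hxy
  have hx : 0 < max x a := lt_max_of_lt_right ha
  have := Real.rpow_le_rpow_of_nonpos hx (max_le_max_right a hxy) (neg_nonpos.mpr hβ)
  dsimp only
  gcongr

/-- **Polynomial eigenvalue decay bound on the effective dimension.**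
If `λ > 0`, `γ ≥ 1`, `1 < β` and `σᵢ ≤ γ·i^(−β)` with `σᵢ ≥ 0` for all `i ≥ 1`, then
`∑_{i≥1} σᵢ/(σᵢ+λ)` converges and is bounded by `γ·(β/(β−1))·λ^(−1/β)`. -/
theorem effective_dimension_polynomial_decay
    (lam γ β : ℝ) (hlam : 0 < lam) (hγ : 1 ≤ γ) (hβ : 1 < β)
    (σ : ℕ → ℝ)
    (hσ0 : ∀ i : ℕ, 1 ≤ i → 0 ≤ σ i)
    (hσ : ∀ i : ℕ, 1 ≤ i → σ i ≤ γ * (i : ℝ) ^ (-β)) :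
    Summable (fun i : ℕ => σ (i + 1) / (σ (i + 1) + lam)) ∧
      ∑' i : ℕ, σ (i + 1) / (σ (i + 1) + lam) ≤ γ * (β / (β - 1)) * lam ^ (-1 / β) := by
  have hγ0 : 0 < γ := by linarith
  have hβ0 : 0 < β := by linarith
  set a : ℝ := (γ / lam) ^ (1 / β) with ha_def
  have ha : 0 < a := by positivity
  have ha_pow : a ^ β = γ / lam := by
    rw [ha_def, ← Real.rpow_mul (by positivity), one_div_mul_cancel hβ0.ne', Real.rpow_one]
  obtain ⟨hint, hval⟩ := integral_Ioi_zero_truncated_rpow ha hβ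
  have hanti := (antitone_truncated_rpow ha hβ0.le).antitoneOn (Set.Ici 0)
  have hpos : ∀ t ∈ Set.Ioi (0 : ℝ), 0 ≤ a ^ β * max t a ^ (-β) := by
    intro t _
    have : 0 < max t a := lt_max_of_lt_right ha
    positivity
  have hsum := (summable_nat_add_iff 1).mpr (hanti.summable_of_integrableOn_Ioi_zero hint hpos)
  have h_nonneg : ∀ i : ℕ, 0 ≤ σ (i + 1) / (σ (i + 1) + lam) := fun i =>
    have := hσ0 (i + 1) (by omega)
    by positivity
  have h_le : ∀ i : ℕ, σ (i + 1) / (σ (i + 1) + lam) ≤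
      a ^ β * max ((i + 1 : ℕ) : ℝ) a ^ (-β) := by
    intro i
    have h0 := hσ0 (i + 1) (by omega)
    rcases le_total ((i + 1 : ℕ) : ℝ) a with h | h
    · rw [max_eq_right h, ← Real.rpow_add ha, add_neg_cancel, Real.rpow_zero]
      exact div_le_one_of_le₀ (by linarith) (by linarith)
    · rw [max_eq_left h, ha_pow]
      calc σ (i + 1) / (σ (i + 1) + lam) ≤ σ (i + 1) / lam := by
            gcongr
            linarith
        _ ≤ γ * ((i + 1 : ℕ) : ℝ) ^ (-β) / lam := by
            gcongr
            exact hσ (i + 1) (by omega)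
        _ = γ / lam * ((i + 1 : ℕ) : ℝ) ^ (-β) := by ring
  have hsummable := hsum.of_nonneg_of_le h_nonneg h_le
  refine ⟨hsummable, ?_⟩
  have ha_le : a ≤ γ * lam ^ (-1 / β) := by
    rw [ha_def, Real.div_rpow hγ0.le hlam.le, neg_div, Real.rpow_neg hlam.le, ← div_eq_mul_inv]
    gcongr
    exact Real.rpow_le_self_of_one_le hγ ((div_le_one hβ0).mpr hβ.le)
  have hc : 0 ≤ β / (β - 1) := div_nonneg hβ0.le (by linarith)
  calc ∑' i : ℕ, σ (i + 1) / (σ (i + 1) + lam)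
      ≤ ∑' i : ℕ, a ^ β * max ((i + 1 : ℕ) : ℝ) a ^ (-β) := hsummable.tsum_le_tsum h_le hsum
    _ ≤ β / (β - 1) * a := hval ▸ hanti.tsum_add_one_le_integral hint hpos
    _ ≤ β / (β - 1) * (γ * lam ^ (-1 / β)) := by gcongr
    _ = γ * (β / (β - 1)) * lam ^ (-1 / β) := by ring
end

section
/- Let λ > 0, γ > 0 and β > 0, and let (σ_i)_{i≥1} be a sequence of nonnegative real numbers such that σ_i ≤ γ·e^{−β i} for every integer i ≥ 1. Then the series ∑_{i=1}^∞ σ_i/(σ_i + λ) converges and ∑_{i=1}^∞ σ_i/(σ_i + λ) ≤ (1/β)·ln(1 + γ/λ). -/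
/-- Convexity of the exponential along the segment from `0` to `β`, in logarithmic form. -/
theorem mul_div_one_add_le_log_sub_log {u : ℝ} (hu : 0 ≤ u) (β : ℝ) :
    β * (u / (1 + u)) ≤ Real.log (1 + u * Real.exp β) - Real.log (1 + u) := by
  have hpos : 0 < 1 + u := by positivity
  have hpos' : 0 < 1 + u * Real.exp β := by positivity
  rw [← Real.log_div hpos'.ne' hpos.ne', Real.le_log_iff_exp_le (by positivity)]
  have h := convexOn_exp.2 (Set.mem_univ 0) (Set.mem_univ β)
    (by positivity : 0 ≤ 1 / (1 + u)) (by positivity : 0 ≤ u / (1 + u)) (by field_simp)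
  simp only [smul_eq_mul, mul_zero, zero_add, Real.exp_zero, mul_one] at h
  calc Real.exp (β * (u / (1 + u))) = Real.exp (u / (1 + u) * β) := by rw [mul_comm]
    _ ≤ 1 / (1 + u) + u / (1 + u) * Real.exp β := h
    _ = (1 + u * Real.exp β) / (1 + u) := by ring

/-- **Exponential eigenvalue decay bound on the effective dimension.**
If `λ > 0`, `γ > 0`, `β > 0` and `σᵢ ≤ γ·e^(−β·i)` with `σᵢ ≥ 0` for all `i ≥ 1`, then
`∑_{i≥1} σᵢ/(σᵢ+λ)` converges and is bounded by `(1/β)·ln(1 + γ/λ)`. -/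
theorem effective_dimension_exponential_decay
    (lam γ β : ℝ) (hlam : 0 < lam) (hγ : 0 < γ) (hβ : 0 < β)
    (σ : ℕ → ℝ)
    (hσ0 : ∀ i : ℕ, 1 ≤ i → 0 ≤ σ i)
    (hσ : ∀ i : ℕ, 1 ≤ i → σ i ≤ γ * Real.exp (-β * i)) :
    Summable (fun i : ℕ => σ (i + 1) / (σ (i + 1) + lam)) ∧
      ∑' i : ℕ, σ (i + 1) / (σ (i + 1) + lam) ≤ (1 / β) * Real.log (1 + γ / lam) := by
  have hterm_nonneg : ∀ i : ℕ, 0 ≤ σ (i + 1) / (σ (i + 1) + lam) := fun i => by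
    have := hσ0 (i + 1) (by omega)
    positivity
  let L : ℕ → ℝ := fun i => Real.log (1 + γ / lam * Real.exp (-β * i))
  have hterm : ∀ i : ℕ, σ (i + 1) / (σ (i + 1) + lam) ≤ 1 / β * (L i - L (i + 1)) := by
    intro i
    have h0 := hσ0 (i + 1) (by omega)
    have h1 := hσ (i + 1) (by omega)
    set u : ℝ := γ / lam * Real.exp (-β * (i + 1 : ℕ)) with hu
    have hu0 : 0 ≤ u := by positivity
    have hlu : lam * u = γ * Real.exp (-β * (i + 1 : ℕ)) := by
      rw [hu]
      field_simp
    have hshift : u * Real.exp β = γ / lam * Real.exp (-β * i) := by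
      rw [hu, mul_assoc, ← Real.exp_add]
      push_cast
      ring_nf
    have hlog := mul_div_one_add_le_log_sub_log hu0 β
    rw [hshift] at hlog
    have hfrac : σ (i + 1) / (σ (i + 1) + lam) ≤ u / (1 + u) := by
      rw [div_le_div_iff₀ (by positivity) (by positivity)]
      linarith
    rw [one_div, inv_mul_eq_div, le_div_iff₀' hβ]
    exact (mul_le_mul_of_nonneg_left hfrac hβ.le).trans hlog
  have hsum : ∀ n : ℕ, ∑ i ∈ Finset.range n, σ (i + 1) / (σ (i + 1) + lam) ≤
      1 / β * Real.log (1 + γ / lam) := by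
    intro n
    have hL0 : L 0 = Real.log (1 + γ / lam) := by simp [L]
    have hLn : 0 ≤ L n := Real.log_nonneg (le_add_of_nonneg_right (by positivity))
    calc ∑ i ∈ Finset.range n, σ (i + 1) / (σ (i + 1) + lam)
        ≤ ∑ i ∈ Finset.range n, 1 / β * (L i - L (i + 1)) :=
          Finset.sum_le_sum fun i _ => hterm i
      _ = 1 / β * (L 0 - L n) := by rw [← Finset.mul_sum, Finset.sum_range_sub']
      _ ≤ 1 / β * Real.log (1 + γ / lam) := by
          rw [← hL0]
          gcongr
          linarith
  exact ⟨summable_of_sum_range_le hterm_nonneg hsum,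
    Real.tsum_le_of_sum_range_le hterm_nonneg hsum⟩
end

section
/- Let X be a measurable space, let μ and ν be measures on X with ν absolutely continuous with respect to μ and with Radon–Nikodym derivative dν/dμ ≤ G μ-almost everywhere, for some constant G ≥ 0. Let H be a real Hilbert space and k : X → H a strongly measurable map with ∫‖k(x)‖² dμ(x) < ∞ and ∫‖k(x)‖² dν(x) < ∞. Suppose Σ_μ and Σ_ν are positive bounded self-adjoint operators on H (the covariance operators) satisfying ⟨f, Σ_μ f⟩ = ∫ ⟨f, k(x)⟩² dμ(x) and ⟨f, Σ_ν f⟩ = ∫ ⟨f, k(x)⟩² dν(x) for every f ∈ H. Then for every λ > 0 the operator Σ_μ + λI is invertible and ‖(Σ_μ + λI)^{−1/2} Σ_ν (Σ_μ + λI)^{−1/2}‖ ≤ G. -/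
open MeasureTheory
open scoped RealInnerProductSpace

theorem MeasureTheory.Measure.le_smul_of_rnDeriv_le {X : Type*} [MeasurableSpace X]
    {μ ν : Measure X} [ν.HaveLebesgueDecomposition μ] (hac : ν ≪ μ) {c : ENNReal}
    (h : ∀ᵐ x ∂μ, ν.rnDeriv μ x ≤ c) : ν ≤ c • μ :=
  calc ν = μ.withDensity (ν.rnDeriv μ) := (Measure.withDensity_rnDeriv_eq ν μ hac).symm
    _ ≤ μ.withDensity fun _ => c := withDensity_mono h
    _ = c • μ := withDensity_const c

theorem ContinuousLinearMap.IsPositive.norm_le_of_inner_le {H : Type*} [NormedAddCommGroup H]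
    [InnerProductSpace ℝ H] {T : H →L[ℝ] H} (hT : T.IsPositive) {c : ℝ} (hc : 0 ≤ c)
    (h : ∀ x, ⟪T x, x⟫ ≤ c * ‖x‖ ^ 2) : ‖T‖ ≤ c := by
  rw [T.norm_eq_iSup_rayleighQuotient hT.isSymmetric]
  refine ciSup_le fun x => ?_
  have hx : T.rayleighQuotient x = ⟪T x, x⟫ / ‖x‖ ^ 2 := rfl
  rw [hx, abs_of_nonneg (div_nonneg (hT.inner_nonneg_left x) (sq_nonneg _))]
  exact div_le_of_le_mul₀ (sq_nonneg _) hc (h x)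

theorem ContinuousLinearMap.IsPositive.isUnit_add_smul_one {H : Type*} [NormedAddCommGroup H]
    [InnerProductSpace ℝ H] [CompleteSpace H] {T : H →L[ℝ] H} (hT : T.IsPositive) {c : ℝ}
    (hc : 0 < c) : IsUnit (T + c • (1 : H →L[ℝ] H)) := by
  refine ContinuousLinearMap.isUnit_of_forall_le_norm_inner_map _ (c := c.toNNReal)
    (Real.toNNReal_pos.2 hc) fun x => ?_
  have hx : ⟪(T + c • (1 : H →L[ℝ] H)) x, x⟫ = ⟪T x, x⟫ + c * ‖x‖ ^ 2 := by
    simp [inner_add_left, real_inner_smul_left]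
  rw [hx, Real.coe_toNNReal c hc.le, mul_comm]
  exact (le_add_of_nonneg_left (hT.inner_nonneg_left x)).trans (Real.le_norm_self _)

/-- **Comparison of covariance operators through a bounded Radon–Nikodym derivative.**
If `ν ≪ μ` with `dν/dμ ≤ G` μ-a.e., and `Covμ`, `Covν` are the covariance operators of the
feature map `k` under `μ` and `ν` respectively, then for every `λ > 0` the operator
`Covμ + λI` is invertible and `‖(Covμ + λI)^(−1/2) Covν (Covμ + λI)^(−1/2)‖ ≤ G`.  The inverse
square root is characterized as the positive operator `R` with `R² = (Covμ + λI)⁻¹`. -/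
theorem covariance_comparison_of_bounded_rnDeriv
    {X : Type*} [MeasurableSpace X] (μ ν : Measure X)
    [ν.HaveLebesgueDecomposition μ] (hac : ν ≪ μ)
    (G : ℝ) (hG : 0 ≤ G)
    (hbound : ∀ᵐ x ∂μ, ν.rnDeriv μ x ≤ ENNReal.ofReal G)
    {H : Type*} [NormedAddCommGroup H] [InnerProductSpace ℝ H] [CompleteSpace H]
    (k : X → H) (hk : StronglyMeasurable k)
    (hkμ : Integrable (fun x => ‖k x‖ ^ 2) μ)
    (hkν : Integrable (fun x => ‖k x‖ ^ 2) ν)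
    (Covμ Covν : H →L[ℝ] H) (hCovμ : Covμ.IsPositive) (hCovν : Covν.IsPositive)
    (hμq : ∀ f : H, ⟪f, Covμ f⟫ = ∫ x, ⟪f, k x⟫ ^ 2 ∂μ)
    (hνq : ∀ f : H, ⟪f, Covν f⟫ = ∫ x, ⟪f, k x⟫ ^ 2 ∂ν)
    (lam : ℝ) (hlam : 0 < lam) :
    IsUnit (Covμ + lam • (1 : H →L[ℝ] H)) ∧
      ∀ R : H →L[ℝ] H, R.IsPositive →
        (R ∘L R) ∘L (Covμ + lam • (1 : H →L[ℝ] H)) = 1 →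
        (Covμ + lam • (1 : H →L[ℝ] H)) ∘L (R ∘L R) = 1 →
        ‖R ∘L Covν ∘L R‖ ≤ G := by
  refine ⟨hCovμ.isUnit_add_smul_one hlam, fun R hR h₁ h₂ => ?_⟩
  have hquad (f : H) : ⟪f, Covν f⟫ ≤ G * ⟪f, Covμ f⟫ := by
    have hint : Integrable (fun x => ⟪f, k x⟫ ^ 2) μ := by
      refine (hkμ.const_mul (‖f‖ ^ 2)).mono'
        ((hk.aestronglyMeasurable.const_inner (𝕜 := ℝ)).pow 2) (.of_forall fun x => ?_)
      rw [Real.norm_of_nonneg (sq_nonneg _), ← mul_pow, ← sq_abs]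
      gcongr
      exact abs_real_inner_le_norm f (k x)
    calc ⟪f, Covν f⟫ = ∫ x, ⟪f, k x⟫ ^ 2 ∂ν := hνq f
      _ ≤ ∫ x, ⟪f, k x⟫ ^ 2 ∂(ENNReal.ofReal G • μ) :=
        integral_mono_measure (Measure.le_smul_of_rnDeriv_le hac hbound)
          (.of_forall fun x => sq_nonneg _) (hint.smul_measure ENNReal.ofReal_ne_top)
      _ = G * ⟪f, Covμ f⟫ := by
        rw [integral_smul_measure, ENNReal.toReal_ofReal hG, hμq, smul_eq_mul]
  set A := Covμ + lam • (1 : H →L[ℝ] H) with hA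
  have hcomm : A * R = R * A := left_inv_eq_right_inv (a := R)
    (by rw [mul_assoc]; exact h₂) (by rw [← mul_assoc]; exact h₁)
  have hRAR : R * (A * R) = 1 := by rw [hcomm, ← mul_assoc]; exact h₁
  have hpos : (R ∘L Covν ∘L R).IsPositive := by
    simpa [hR.isSelfAdjoint.adjoint_eq] using hCovν.conj_adjoint R
  refine hpos.norm_le_of_inner_le hG fun g => ?_
  calc ⟪R (Covν (R g)), g⟫ = ⟪R g, Covν (R g)⟫ := by
        rw [hR.inner_left_eq_inner_right, real_inner_comm]
    _ ≤ G * ⟪R g, Covμ (R g)⟫ := hquad (R g)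
    _ ≤ G * ⟪R g, A (R g)⟫ := by
      gcongr
      simp only [hA, add_apply, smul_apply,
        one_apply_eq_self, inner_add_right, real_inner_smul_right]
      exact le_add_of_nonneg_right (mul_nonneg hlam.le real_inner_self_nonneg)
    _ = G * ‖g‖ ^ 2 := by
      have hg : R (A (R g)) = g := congrArg (fun T : H →L[ℝ] H => T g) hRAR
      rw [hR.inner_left_eq_inner_right, hg, real_inner_self_eq_norm_sq]
end

section
/- Let H be a real Hilbert space, n a positive integer, k_1, …, k_n ∈ H, y ∈ ℝ^n, w_1, …, w_n ≥ 0 and λ > 0. Let E be a finite-dimensional real inner product space and V : E → H a linear isometry, i.e. V*V = I_E. Define Â_w : H → H by Â_w f = (1/n) ∑_{i=1}^n w_i ⟨k_i, f⟩ k_i and b = (1/n) ∑_{i=1}^n w_i y_i k_i. Then V*Â_wV + λI_E is invertible, the vector f̂ := V (V*Â_wV + λI_E)^{−1} V* b belongs to the subspace ran(V) = {Vβ : β ∈ E}, and f̂ is the unique minimizer of the regularized importance-weighted empirical risk F over ran(V). -/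
open scoped RealInnerProductSpace

/-- A coercive operator on a finite-dimensional inner product space is invertible. -/
theorem isUnit_of_coercive {E : Type*} [NormedAddCommGroup E] [InnerProductSpace ℝ E]
    [FiniteDimensional ℝ E] (T : E →L[ℝ] E) {c : ℝ} (hc : 0 < c)
    (hT : ∀ x, c * ‖x‖ ^ 2 ≤ ⟪T x, x⟫) : IsUnit T := by
  have hinj : Function.Injective (T : E →ₗ[ℝ] E) := by
    refine (injective_iff_map_eq_zero _).2 fun x hx => ?_
    have h := hT x
    rw [show T x = 0 from hx, inner_zero_left] at h
    have : ‖x‖ ^ 2 = 0 := le_antisymm (nonpos_of_mul_nonpos_right h hc) (sq_nonneg _)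
    simpa using this
  have hbij : Function.Bijective T := ⟨hinj, LinearMap.injective_iff_surjective.1 hinj⟩
  have : CompleteSpace E := FiniteDimensional.complete ℝ E
  exact ContinuousLinearMap.isUnit_iff_bijective.2 hbij

theorem inner_smul_sum_smul {H ι : Type*} [NormedAddCommGroup H] [InnerProductSpace ℝ H]
    [Fintype ι] (a : ℝ) (c : ι → ℝ) (k : ι → H) (h : H) :
    ⟪a • ∑ i, c i • k i, h⟫ = a * ∑ i, c i * ⟪k i, h⟫ := by
  simp only [real_inner_smul_left, sum_inner]

/-- Exact second-order expansion of the regularized weighted empirical risk. -/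
theorem weighted_risk_add {H ι : Type*} [NormedAddCommGroup H] [InnerProductSpace ℝ H]
    [Fintype ι] (a lam : ℝ) (k : ι → H) (y w : ι → ℝ) (f h : H) :
    a * ∑ i, w i * (y i - ⟪k i, f + h⟫) ^ 2 + lam * ‖f + h‖ ^ 2 =
      (a * ∑ i, w i * (y i - ⟪k i, f⟫) ^ 2 + lam * ‖f‖ ^ 2) +
        2 * (a * ∑ i, (w i * ⟪k i, f⟫) * ⟪k i, h⟫ + lam * ⟪f, h⟫ -
          a * ∑ i, (w i * y i) * ⟪k i, h⟫) +
        (a * ∑ i, w i * ⟪k i, h⟫ ^ 2 + lam * ‖h‖ ^ 2) := by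
  have key : ∑ i, w i * (y i - ⟪k i, f + h⟫) ^ 2 =
      ∑ i, w i * (y i - ⟪k i, f⟫) ^ 2 + 2 * ∑ i, (w i * ⟪k i, f⟫) * ⟪k i, h⟫ -
        2 * ∑ i, (w i * y i) * ⟪k i, h⟫ + ∑ i, w i * ⟪k i, h⟫ ^ 2 := by
    simp only [Finset.mul_sum, ← Finset.sum_add_distrib, ← Finset.sum_sub_distrib]
    refine Finset.sum_congr rfl fun i _ => ?_
    rw [inner_add_right]
    ring
  rw [key, norm_add_sq_real]
  ring

/-- **Closed form of the Nyström importance-weighted KRR estimator.**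
With `V : E → H` a linear isometry (`V*V = I`), `Â_w f = (1/n) ∑ᵢ wᵢ ⟨kᵢ, f⟩ kᵢ` and
`b = (1/n) ∑ᵢ wᵢ yᵢ kᵢ`, the operator `V*Â_wV + λI` is invertible, and
`f̂ = V (V*Â_wV + λI)⁻¹ V* b` lies in `ran V` and is the unique minimizer over `ran V`
of the regularized importance-weighted empirical risk
`F(f) = (1/n) ∑ᵢ wᵢ (yᵢ − ⟨kᵢ, f⟩)² + λ‖f‖²`. -/
theorem nystrom_weighted_krr_estimator
    {H E : Type*} [NormedAddCommGroup H] [InnerProductSpace ℝ H] [CompleteSpace H]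
    [NormedAddCommGroup E] [InnerProductSpace ℝ E] [FiniteDimensional ℝ E]
    (V : E →L[ℝ] H) (hV : V.adjoint ∘L V = 1)
    (n : ℕ) (hn : 0 < n) (k : Fin n → H) (y : Fin n → ℝ) (w : Fin n → ℝ)
    (hw : ∀ i, 0 ≤ w i) (lam : ℝ) (hlam : 0 < lam)
    (Aw : H →L[ℝ] H)
    (hAw : ∀ f : H, Aw f = (1 / (n : ℝ)) • ∑ i, (w i * ⟪k i, f⟫) • k i) :
    IsUnit (V.adjoint ∘L Aw ∘L V + lam • (1 : E →L[ℝ] E)) ∧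
      ∀ fhat : H,
        fhat = V (Ring.inverse (V.adjoint ∘L Aw ∘L V + lam • (1 : E →L[ℝ] E))
            (V.adjoint ((1 / (n : ℝ)) • ∑ i, (w i * y i) • k i))) →
        fhat ∈ Set.range (⇑V) ∧
          ∀ g ∈ Set.range (⇑V), g ≠ fhat →
            (1 / (n : ℝ)) * ∑ i, w i * (y i - ⟪k i, fhat⟫) ^ 2 + lam * ‖fhat‖ ^ 2 <
              (1 / (n : ℝ)) * ∑ i, w i * (y i - ⟪k i, g⟫) ^ 2 + lam * ‖g‖ ^ 2 := by
  have hVV (x : E) : V.adjoint (V x) = x := DFunLike.congr_fun hV x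
  have hVinner (x z : E) : ⟪V x, V z⟫ = ⟪x, z⟫ := by
    rw [← ContinuousLinearMap.adjoint_inner_left, hVV]
  have hT (x z : E) : ⟪(V.adjoint ∘L Aw ∘L V + lam • (1 : E →L[ℝ] E)) x, z⟫ =
      1 / (n : ℝ) * ∑ i, (w i * ⟪k i, V x⟫) * ⟪k i, V z⟫ + lam * ⟪V x, V z⟫ := by
    rw [hVinner, ← inner_smul_sum_smul, ← hAw, ← ContinuousLinearMap.adjoint_inner_left,
      ← real_inner_smul_left, ← inner_add_left]
    rfl
  have hquad (h : H) : 0 ≤ 1 / (n : ℝ) * ∑ i, w i * ⟪k i, h⟫ ^ 2 :=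
    mul_nonneg (by positivity) (Finset.sum_nonneg fun i _ => mul_nonneg (hw i) (sq_nonneg _))
  have hunit : IsUnit (V.adjoint ∘L Aw ∘L V + lam • (1 : E →L[ℝ] E)) := by
    refine isUnit_of_coercive _ hlam fun x => ?_
    rw [hT, hVinner, real_inner_self_eq_norm_sq]
    have := hquad (V x)
    simp only [sq, ← mul_assoc] at this ⊢
    linarith
  refine ⟨hunit, ?_⟩
  rintro fhat rfl
  refine ⟨⟨_, rfl⟩, ?_⟩
  set T := V.adjoint ∘L Aw ∘L V + lam • (1 : E →L[ℝ] E)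
  set b := (1 / (n : ℝ)) • ∑ i, (w i * y i) • k i with hb
  set β := Ring.inverse T (V.adjoint b)
  have hTβ : T β = V.adjoint b := DFunLike.congr_fun (Ring.mul_inverse_cancel T hunit) _
  rintro _ ⟨γ, rfl⟩ hne
  have hcross := hT β (γ - β)
  rw [hTβ, ContinuousLinearMap.adjoint_inner_left, hb, inner_smul_sum_smul] at hcross
  have hpos : 0 < lam * ‖V (γ - β)‖ ^ 2 := by
    have : V (γ - β) ≠ 0 := by rwa [map_sub, sub_ne_zero]
    positivity
  have hexp := weighted_risk_add (1 / (n : ℝ)) lam k y w (V β) (V (γ - β))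
  rw [← map_add, add_sub_cancel] at hexp
  rw [hexp]
  linarith [hquad (V (γ - β))]
end

section
/- Let H be a real Hilbert space, n a positive integer, k_1, …, k_n ∈ H, y ∈ ℝ^n, w_1, …, w_n ≥ 0 and λ > 0. Let ψ_1, …, ψ_m ∈ H and define the matrices K_{nm} ∈ ℝ^{n×m} with (K_{nm})_{ij} = ⟨k_i, ψ_j⟩, K_{mm} ∈ ℝ^{m×m} with (K_{mm})_{ij} = ⟨ψ_i, ψ_j⟩, and the diagonal matrix M_w = diag(w_1, …, w_n). Assume the matrix B := K_{nm}ᵀ M_w K_{nm} + nλ K_{mm} is invertible. Then, with c := B^{−1} K_{nm}ᵀ M_w y ∈ ℝ^m, the vector f̂ := ∑_{j=1}^m c_j ψ_j is the unique minimizer of the regularized importance-weighted empirical risk F over the subspace span{ψ_1, …, ψ_m}. -/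
open Matrix
open scoped RealInnerProductSpace

/-- A critical point of the regularized weighted empirical risk in the direction `g - f` has
strictly smaller risk than `g`. -/
theorem weightedRisk_lt_of_stationary {H ι : Type*} [NormedAddCommGroup H]
    [InnerProductSpace ℝ H] [Fintype ι] {a : ℝ} (ha : 0 < a) (k : ι → H) (y w : ι → ℝ)
    (hw : ∀ i, 0 ≤ w i) {lam : ℝ} (hlam : 0 < lam) {f g : H} (hne : g ≠ f)
    (hstat : ∑ i, w i * (y i - ⟪k i, f⟫) * ⟪k i, g - f⟫ = a * lam * ⟪f, g - f⟫) :
    (1 / a) * ∑ i, w i * (y i - ⟪k i, f⟫) ^ 2 + lam * ‖f‖ ^ 2 <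
      (1 / a) * ∑ i, w i * (y i - ⟪k i, g⟫) ^ 2 + lam * ‖g‖ ^ 2 := by
  obtain ⟨d, rfl⟩ : ∃ d, g = f + d := ⟨g - f, by abel⟩
  have hd : d ≠ 0 := by rintro rfl; simp at hne
  rw [add_sub_cancel_left] at hstat
  have hsum : ∑ i, w i * (y i - ⟪k i, f + d⟫) ^ 2 =
      ∑ i, w i * (y i - ⟪k i, f⟫) ^ 2 - 2 * ∑ i, w i * (y i - ⟪k i, f⟫) * ⟪k i, d⟫ +
        ∑ i, w i * ⟪k i, d⟫ ^ 2 := by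
    rw [Finset.mul_sum, ← Finset.sum_sub_distrib, ← Finset.sum_add_distrib]
    refine Finset.sum_congr rfl fun i _ => ?_
    rw [inner_add_right]
    ring
  have hnonneg : 0 ≤ (1 / a) * ∑ i, w i * ⟪k i, d⟫ ^ 2 :=
    mul_nonneg (by positivity) (Finset.sum_nonneg fun i _ => mul_nonneg (hw i) (sq_nonneg _))
  have hpos : 0 < lam * ‖d‖ ^ 2 := by positivity
  have hcancel : (1 / a) * (2 * (a * lam * ⟪f, d⟫)) = 2 * lam * ⟪f, d⟫ := by
    field_simp
  rw [hsum, hstat, norm_add_sq_real, mul_add, mul_sub, hcancel]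
  linarith

/-- The normal equations in coordinates are the stationarity conditions along the span. -/
theorem stationary_of_mem_span {H ι κ : Type*} [NormedAddCommGroup H] [InnerProductSpace ℝ H]
    [Fintype ι] (k : ι → H) (r : ι → ℝ) (b : ℝ) (f : H) (ψ : κ → H)
    (h : ∀ j, ∑ i, r i * ⟪k i, ψ j⟫ = b * ⟪f, ψ j⟫) {d : H}
    (hd : d ∈ Submodule.span ℝ (Set.range ψ)) :
    ∑ i, r i * ⟪k i, d⟫ = b * ⟪f, d⟫ := by
  have hmem : ∀ x, ⟪∑ i, r i • k i - b • f, x⟫ = ∑ i, r i * ⟪k i, x⟫ - b * ⟪f, x⟫ := fun x => by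
    simp [inner_sub_left, sum_inner, real_inner_smul_left]
  rw [← sub_eq_zero, ← hmem]
  induction hd using Submodule.span_induction with
  | mem x hx =>
    obtain ⟨j, rfl⟩ := hx
    rw [hmem, h, sub_self]
  | zero => exact inner_zero_right _
  | add x z _ _ hx hz => rw [inner_add_right, hx, hz, add_zero]
  | smul t x _ hx => rw [real_inner_smul_right, hx, mul_zero]

/-- **Representer-theorem form of the Nyström importance-weighted KRR estimator.**
With `(K_{nm})_{ij} = ⟨kᵢ, ψⱼ⟩`, `(K_{mm})_{ij} = ⟨ψᵢ, ψⱼ⟩`, `M_w = diag(w)`, and assuming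
`B = K_{nm}ᵀ M_w K_{nm} + nλ K_{mm}` invertible, the vector `f̂ = ∑ⱼ cⱼ ψⱼ` with
`c = B⁻¹ K_{nm}ᵀ M_w y` is the unique minimizer of
`F(f) = (1/n) ∑ᵢ wᵢ (yᵢ − ⟨kᵢ, f⟩)² + λ‖f‖²` over `span{ψ₁, …, ψ_m}`. -/
theorem nystrom_weighted_krr_representer
    {H : Type*} [NormedAddCommGroup H] [InnerProductSpace ℝ H] [CompleteSpace H]
    (n : ℕ) (hn : 0 < n) (k : Fin n → H) (y : Fin n → ℝ) (w : Fin n → ℝ)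
    (hw : ∀ i, 0 ≤ w i) (lam : ℝ) (hlam : 0 < lam)
    (m : ℕ) (ψ : Fin m → H)
    (Knm : Matrix (Fin n) (Fin m) ℝ) (hKnm : ∀ i j, Knm i j = ⟪k i, ψ j⟫)
    (Kmm : Matrix (Fin m) (Fin m) ℝ) (hKmm : ∀ i j, Kmm i j = ⟪ψ i, ψ j⟫)
    (B : Matrix (Fin m) (Fin m) ℝ)
    (hB : B = Knmᵀ * Matrix.diagonal w * Knm + ((n : ℝ) * lam) • Kmm)
    (hBu : IsUnit B) :
    ∀ c : Fin m → ℝ, c = B⁻¹ *ᵥ (Knmᵀ *ᵥ (Matrix.diagonal w *ᵥ y)) →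
      ∀ fhat : H, fhat = ∑ j, c j • ψ j →
        fhat ∈ Submodule.span ℝ (Set.range ψ) ∧
          ∀ g ∈ Submodule.span ℝ (Set.range ψ), g ≠ fhat →
            (1 / (n : ℝ)) * ∑ i, w i * (y i - ⟪k i, fhat⟫) ^ 2 + lam * ‖fhat‖ ^ 2 <
              (1 / (n : ℝ)) * ∑ i, w i * (y i - ⟪k i, g⟫) ^ 2 + lam * ‖g‖ ^ 2 := by
  rintro c hc fhat rfl
  have hf : ∑ j, c j • ψ j ∈ Submodule.span ℝ (Set.range ψ) :=
    Submodule.sum_mem _ fun j _ => Submodule.smul_mem _ _ (Submodule.subset_span ⟨j, rfl⟩)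
  refine ⟨hf, fun g hg hne => ?_⟩
  refine weightedRisk_lt_of_stationary (Nat.cast_pos.mpr hn) k y w hw hlam hne ?_
  refine stationary_of_mem_span k _ _ _ ψ (fun j => ?_) (Submodule.sub_mem _ hg hf)
  have hnormal : B *ᵥ c = Knmᵀ *ᵥ (Matrix.diagonal w *ᵥ y) := by
    rw [hc, mulVec_mulVec, mul_nonsing_inv _ ((isUnit_iff_isUnit_det B).mp hBu), one_mulVec]
  have hk : ∀ i, ⟪k i, ∑ l, c l • ψ l⟫ = (Knm *ᵥ c) i := fun i => by
    simp [inner_sum, real_inner_smul_right, mulVec, dotProduct, hKnm, mul_comm]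
  have hψ : ⟪∑ l, c l • ψ l, ψ j⟫ = (Kmm *ᵥ c) j := by
    rw [real_inner_comm]
    simp [inner_sum, real_inner_smul_right, mulVec, dotProduct, hKmm, mul_comm]
  rw [hB, add_mulVec, smul_mulVec, ← mulVec_mulVec, ← mulVec_mulVec] at hnormal
  have hj := congrFun hnormal j
  rw [Pi.add_apply, Pi.smul_apply, smul_eq_mul, ← eq_sub_iff_add_eq', ← Pi.sub_apply,
    ← mulVec_sub, ← mulVec_sub] at hj
  rw [hψ, hj, mulVec, dotProduct]
  refine Finset.sum_congr rfl fun i _ => ?_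
  rw [hk, mulVec_diagonal, Pi.sub_apply]
  simp only [transpose_apply, hKnm]
  ring
end

section
/- (Cordes inequality) Let A and B be positive bounded self-adjoint operators on a nontrivial real Hilbert space H, and let 0 ≤ s ≤ 1. Then ‖A^s B^s‖ ≤ ‖A B‖^s. -/
open Filter

/-- `B = A ^ s`, the `s`-th power (for `s ≥ 0`) of a positive operator `A` on a real Hilbert
space, given by the continuous functional calculus.  It is characterized as the limit of
`p_n(A)` along any sequence of polynomials `p_n` converging uniformly to `x ↦ x ^ s` on
`[0, ‖A‖]` (which contains the spectrum of `A`); such sequences exist by the Weierstrass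
approximation theorem, and the limit is independent of the chosen sequence. -/
def IsPosPow {H : Type*} [NormedAddCommGroup H] [InnerProductSpace ℝ H] [CompleteSpace H]
    (A : H →L[ℝ] H) (s : ℝ) (B : H →L[ℝ] H) : Prop :=
  ∀ p : ℕ → Polynomial ℝ,
    TendstoUniformlyOn (fun n x => (p n).eval x) (fun x : ℝ => x ^ s) atTop
      (Set.Icc (0 : ℝ) ‖A‖) →
    Tendsto (fun n => Polynomial.aeval A (p n)) atTop (nhds B)

open Polynomial ContinuousLinearMap in
/-- If `q(A)` is not invertible, then `q` has a root in the spectrum of `A`. -/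
theorem IsSelfAdjoint.exists_mem_spectrum_isRoot {H : Type*} [NormedAddCommGroup H]
    [InnerProductSpace ℝ H] [CompleteSpace H] {A : H →L[ℝ] H} (hA : IsSelfAdjoint A)
    {q : ℝ[X]} (hq0 : q ≠ 0) (hq : ¬ IsUnit (aeval A q)) :
    ∃ r ∈ spectrum ℝ A, q.IsRoot r := by
  induction hn : q.natDegree using Nat.strong_induction_on generalizing q with
  | _ n ih =>
  subst hn
  have hdeg : q.degree ≠ 0 := by
    intro h
    rw [eq_C_of_degree_eq_zero h] at hq hq0
    rw [aeval_C] at hq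
    exact hq ((IsUnit.mk0 _ (by simpa using hq0)).map (algebraMap ℝ (H →L[ℝ] H)))
  obtain ⟨z, hz⟩ := IsAlgClosed.exists_aeval_eq_zero ℂ q hdeg
  have key : ∀ g h : ℝ[X], q = g * h → 0 < g.natDegree →
      (IsUnit (aeval A g) ∨ ∃ r ∈ spectrum ℝ A, g.IsRoot r) →
      ∃ r ∈ spectrum ℝ A, q.IsRoot r := by
    rintro g h rfl hg (hu | ⟨r, hr, hgr⟩)
    · have h0 := right_ne_zero_of_mul hq0
      have g0 := left_ne_zero_of_mul hq0
      obtain ⟨r, hr, hhr⟩ := ih h.natDegree (by rw [natDegree_mul g0 h0]; omega) h0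
        (fun hh => hq (by rw [map_mul]; exact hu.mul hh)) rfl
      exact ⟨r, hr, by simp [hhr.eq_zero]⟩
    · exact ⟨r, hr, by simp [hgr.eq_zero]⟩
  by_cases hzi : z.im = 0
  · have hroot : q.IsRoot z.re := by
      have hzr : z = algebraMap ℝ ℂ z.re := by
        apply Complex.ext <;> simp [hzi]
      rw [hzr, aeval_algebraMap_apply] at hz
      simpa using hz
    obtain ⟨h, hh⟩ := dvd_iff_isRoot.2 hroot
    refine key _ h hh (by simp) ?_
    by_cases hu : IsUnit (aeval A (X - C z.re))
    · exact .inl hu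
    · refine .inr ⟨z.re, ?_, by simp⟩
      rw [spectrum.mem_iff, IsUnit.sub_iff]
      simpa using hu
  · obtain ⟨h, hh⟩ := quadratic_dvd_of_aeval_eq_zero_im_ne_zero q hz hzi
    have hd : (X ^ 2 - C (2 * z.re) * X + C (‖z‖ ^ 2) : ℝ[X]).natDegree = 2 := by
      compute_degree!
    refine key _ h hh (by omega) (.inl ?_)
    have hpos : 0 < z.im ^ 2 := by positivity
    refine isUnit_of_forall_le_norm_inner_map _ (c := ⟨z.im ^ 2, hpos.le⟩) hpos fun x => ?_
    have hsym : ∀ u v, inner ℝ (A u) v = inner ℝ u (A v) := hA.isSymmetric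
    have e : inner ℝ (aeval A (X ^ 2 - C (2 * z.re) * X + C (‖z‖ ^ 2)) x) x
        = ‖A x - z.re • x‖ ^ 2 + z.im ^ 2 * ‖x‖ ^ 2 := by
      have h1 : aeval A (X ^ 2 - C (2 * z.re) * X + C (‖z‖ ^ 2)) x
          = A (A x) - (2 * z.re) • A x + (‖z‖ ^ 2) • x := by
        simp [Algebra.algebraMap_eq_smul_one, pow_two]
        module
      rw [h1, ← real_inner_self_eq_norm_sq (A x - z.re • x), ← real_inner_self_eq_norm_sq x,
        Complex.sq_norm, Complex.normSq_apply]
      simp only [inner_add_left, inner_sub_left, inner_sub_right, real_inner_smul_left,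
        real_inner_smul_right, hsym, map_smul]
      ring
    rw [e, Real.norm_of_nonneg (by positivity)]
    change ‖x‖ ^ 2 * z.im ^ 2 ≤ _
    nlinarith [sq_nonneg ‖A x - z.re • x‖]

open ContinuousLinearMap in
theorem IsSelfAdjoint.not_isUnit_norm_sq_sub_sq {H : Type*} [NormedAddCommGroup H]
    [InnerProductSpace ℝ H] [CompleteSpace H] [Nontrivial H] {S : H →L[ℝ] H}
    (hS : IsSelfAdjoint S) : ¬ IsUnit (algebraMap ℝ (H →L[ℝ] H) (‖S‖ ^ 2) - S ^ 2) := by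
  rintro ⟨u, hu⟩
  set K := ‖(↑u⁻¹ : H →L[ℝ] H)‖
  have hK : 0 < K := norm_pos_iff.2 u⁻¹.ne_zero
  set c := ‖S‖
  have happ : ∀ x, (u : H →L[ℝ] H) x = c ^ 2 • x - S (S x) := fun x => by
    simp [hu, Algebra.algebraMap_eq_smul_one, pow_two]
  have hsym : ∀ u v, inner ℝ (S u) v = inner ℝ u (S v) := hS.isSymmetric
  have hR : ∀ x, ‖(u : H →L[ℝ] H) x‖ ^ 2 ≤ c ^ 2 * (c ^ 2 * ‖x‖ ^ 2 - ‖S x‖ ^ 2) := fun x => by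
    have h2 : ‖S (S x)‖ ^ 2 ≤ c ^ 2 * ‖S x‖ ^ 2 := by
      rw [← mul_pow]; gcongr; exact S.le_opNorm _
    rw [happ, norm_sub_sq_real, real_inner_smul_left, ← hsym, real_inner_self_eq_norm_sq,
      norm_smul, mul_pow, Real.norm_of_nonneg (by positivity)]
    nlinarith
  have hlow : ∀ x, ‖x‖ ^ 2 ≤ K ^ 2 * ‖(u : H →L[ℝ] H) x‖ ^ 2 := fun x => by
    rw [← mul_pow]
    gcongr
    calc ‖x‖ = ‖(↑u⁻¹ * ↑u : H →L[ℝ] H) x‖ := by simp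
      _ ≤ _ := (↑u⁻¹ : H →L[ℝ] H).le_opNorm _
  have hc : 0 < c := by
    refine (norm_nonneg S).lt_of_ne fun h0 => ?_
    obtain ⟨x, hx⟩ := exists_ne (0 : H)
    have h1 := hlow x
    have h2 := hR x
    rw [show c = 0 from h0.symm] at h2
    have : 0 < ‖x‖ ^ 2 := by positivity
    nlinarith [sq_nonneg K, mul_nonneg (sq_nonneg K) (sub_nonneg.2 h2)]
  set d := (K ^ 2 * c ^ 2)⁻¹
  have hd : 0 < d := by positivity
  have hle : ∀ x, ‖S x‖ ^ 2 ≤ (c ^ 2 - d) * ‖x‖ ^ 2 := fun x => by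
    have h1 : ‖x‖ ^ 2 ≤ (K ^ 2 * c ^ 2) * (c ^ 2 * ‖x‖ ^ 2 - ‖S x‖ ^ 2) :=
      (hlow x).trans (by rw [mul_assoc]; gcongr; exact hR x)
    have h2 : d * ‖x‖ ^ 2 ≤ c ^ 2 * ‖x‖ ^ 2 - ‖S x‖ ^ 2 := by
      rw [inv_mul_le_iff₀ (by positivity)]; exact h1
    linarith
  have hlt : c ≤ √(c ^ 2 - d) := by
    refine S.opNorm_le_bound (Real.sqrt_nonneg _) fun x => ?_
    rw [← Real.sqrt_sq (norm_nonneg x), ← Real.sqrt_mul' _ (sq_nonneg _)]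
    exact Real.le_sqrt_of_sq_le (hle x)
  exact absurd hlt (not_le.2 ((Real.sqrt_lt' hc).2 (by linarith)))

open Polynomial in
theorem ContinuousLinearMap.isSelfAdjoint_aeval {H : Type*} [NormedAddCommGroup H]
    [InnerProductSpace ℝ H] [CompleteSpace H] {A : H →L[ℝ] H} (hA : IsSelfAdjoint A) (p : ℝ[X]) :
    IsSelfAdjoint (aeval A p) := by
  induction p using Polynomial.induction_on' with
  | add p q hp hq => rw [map_add]; exact hp.add hq
  | monomial n a =>
    rw [aeval_monomial, ← Algebra.smul_def]
    exact (IsSelfAdjoint.all a).smul (hA.pow n)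

open Polynomial in
theorem ContinuousLinearMap.IsPositive.norm_aeval_le {H : Type*} [NormedAddCommGroup H]
    [InnerProductSpace ℝ H] [CompleteSpace H] [Nontrivial H] {A : H →L[ℝ] H} (hA : A.IsPositive)
    (p : ℝ[X]) : ‖aeval A p‖ ≤ ‖p.toContinuousMapOn (Set.Icc 0 ‖A‖)‖ := by
  have hS := isSelfAdjoint_aeval hA.isSelfAdjoint p
  obtain ⟨r, hr, h⟩ : ∃ r ∈ Set.Icc 0 ‖A‖, (C (‖aeval A p‖ ^ 2) - p ^ 2).IsRoot r := by
    by_cases h0 : C (‖aeval A p‖ ^ 2) - p ^ 2 = 0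
    · exact ⟨0, by simp, by rw [h0]; exact IsRoot.def.2 eval_zero⟩
    · obtain ⟨r, hr, h⟩ := hA.isSelfAdjoint.exists_mem_spectrum_isRoot h0
        (by simpa using hS.not_isUnit_norm_sq_sub_sq)
      exact ⟨r, ⟨spectrum_nonneg_of_nonneg (by rwa [nonneg_iff_isPositive]) hr,
        (le_abs_self r).trans (spectrum.norm_le_norm_of_mem hr)⟩, h⟩
  have h1 : ‖aeval A p‖ ^ 2 = (p.eval r) ^ 2 := by
    simpa [sub_eq_zero] using h
  rw [← abs_of_nonneg (norm_nonneg (aeval A p)), (sq_eq_sq_iff_abs_eq_abs _ _).1 h1]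
  exact (p.toContinuousMapOn (Set.Icc 0 ‖A‖)).norm_coe_le_norm ⟨r, hr⟩

open Polynomial in
theorem denseRange_toContinuousMapOnAlgHom_Icc (a b : ℝ) :
    DenseRange (toContinuousMapOnAlgHom (Set.Icc a b)) := fun f => by
  have hf : f ∈ (polynomialFunctions (Set.Icc a b)).topologicalClosure := by
    rw [polynomialFunctions_closure_eq_top]; trivial
  rwa [← SetLike.mem_coe, Subalgebra.topologicalClosure_coe, polynomialFunctions_coe] at hf

open Polynomial in
/-- The continuous functional calculus of a positive operator on a real Hilbert space. -/
theorem ContinuousLinearMap.IsPositive.exists_continuous_extension_aeval {H : Type*}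
    [NormedAddCommGroup H] [InnerProductSpace ℝ H] [CompleteSpace H] [Nontrivial H]
    {A : H →L[ℝ] H} (hA : A.IsPositive) :
    ∃ Φ : C(Set.Icc 0 ‖A‖, ℝ) → H →L[ℝ] H, Continuous Φ ∧
      ∀ p : ℝ[X], Φ (p.toContinuousMapOn _) = aeval A p := by
  let e := toContinuousMapOnAlgHom (Set.Icc 0 ‖A‖)
  let : PseudoMetricSpace ℝ[X] := PseudoMetricSpace.induced e inferInstance
  have hu : IsUniformInducing e := ⟨rfl⟩
  have hd : DenseRange e := denseRange_toContinuousMapOnAlgHom_Icc 0 ‖A‖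
  have hφ : UniformContinuous (aeval A : ℝ[X] → H →L[ℝ] H) := by
    refine (LipschitzWith.mk_one fun p q => ?_).uniformContinuous
    change _ ≤ dist (e p) (e q)
    rw [dist_eq_norm, dist_eq_norm, ← map_sub, ← map_sub]
    exact hA.norm_aeval_le (p - q)
  exact ⟨_, (uniformContinuous_uniformly_extend hu hd hφ).continuous,
    uniformly_extend_of_ind hu hd hφ⟩

open Polynomial in
/-- The powers of a positive operator form a semigroup of self-adjoint operators that is
norm-continuous at positive exponents. -/
theorem ContinuousLinearMap.IsPositive.exists_rpow_family {H : Type*}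
    [NormedAddCommGroup H] [InnerProductSpace ℝ H] [CompleteSpace H] [Nontrivial H]
    {A : H →L[ℝ] H} (hA : A.IsPositive) :
    ∃ F : ℝ → H →L[ℝ] H, (∀ s, 0 ≤ s → ∀ X, IsPosPow A s X → X = F s) ∧
      (∀ s t, 0 ≤ s → 0 ≤ t → F (s + t) = F s * F t) ∧ (∀ s, IsSelfAdjoint (F s)) ∧
      F 0 = 1 ∧ F 1 = A ∧ ContinuousOn F (Set.Ioi 0) := by
  obtain ⟨Φ, hΦ, hp⟩ := hA.exists_continuous_extension_aeval
  let e := toContinuousMapOnAlgHom (Set.Icc 0 ‖A‖)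
  have hd : DenseRange e := denseRange_toContinuousMapOnAlgHom_Icc 0 ‖A‖
  have he : ∀ p, Φ (e p) = aeval A p := hp
  have hmul : ∀ f g, Φ (f * g) = Φ f * Φ g := fun f g => by
    refine hd.induction_on₂ (p := fun f g => Φ (f * g) = Φ f * Φ g) ?_ ?_ f g
    · exact isClosed_eq (by fun_prop) (by fun_prop)
    · intro p q
      rw [← map_mul, he, he, he, map_mul]
  have hsa : ∀ f, IsSelfAdjoint (Φ f) := fun f => by
    refine hd.induction_on (p := fun f => IsSelfAdjoint (Φ f)) f ?_ fun p => ?_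
    · exact isClosed_eq (by fun_prop) hΦ
    · rw [he]
      exact isSelfAdjoint_aeval hA.isSelfAdjoint p
  let f : ℝ → C(Set.Icc 0 ‖A‖, ℝ) := fun s =>
    ⟨fun x => (x : ℝ) ^ max s 0, continuous_subtype_val.rpow_const fun _ => .inr (le_max_right _ _)⟩
  refine ⟨fun s => Φ (f s), fun s hs X hX => ?_, fun s t hs ht => ?_, fun s => hsa _, ?_, ?_, ?_⟩
  · obtain ⟨u, hu, hlim⟩ := mem_closure_iff_seq_limit.1 (hd (f s))
    choose p hpu using hu
    have hlim' : Tendsto (fun n => e (p n)) atTop (nhds (f s)) := by simpa only [hpu] using hlim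
    have h1 : Tendsto (fun n => aeval A (p n)) atTop (nhds (Φ (f s))) := by
      simpa only [Function.comp_def, he] using (hΦ.tendsto _).comp hlim'
    refine tendsto_nhds_unique (hX p ?_) h1
    rw [tendstoUniformlyOn_iff_tendstoUniformly_comp_coe]
    have h2 := ContinuousMap.tendsto_iff_tendstoUniformly.1 hlim'
    have h3 : (f s : Set.Icc 0 ‖A‖ → ℝ) = (fun x : ℝ => x ^ s) ∘ Subtype.val := by
      ext x; simp [f, max_eq_left hs]
    rw [h3] at h2
    exact h2
  · have : f (s + t) = f s * f t := by
      ext x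
      simp [f, max_eq_left hs, max_eq_left ht, max_eq_left (add_nonneg hs ht),
        Real.rpow_add_of_nonneg x.2.1 hs ht]
    simp only [this, hmul]
  · have : f 0 = e 1 := by ext x; simp [f, e]
    exact (congrArg Φ this).trans ((he 1).trans (map_one _))
  · have : f 1 = e X := by ext x; simp [f, e]
    simp only [this, he, aeval_X]
  · rw [continuousOn_iff_continuous_domRestrict]
    refine hΦ.comp (ContinuousMap.continuous_of_continuous_uncurry
      (fun s : Set.Ioi (0 : ℝ) => f s) ?_)
    rw [continuous_iff_continuousAt]
    rintro ⟨⟨s, hs⟩, x⟩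
    have hs' : 0 < max s 0 := lt_max_of_lt_left hs
    exact ContinuousAt.rpow (by fun_prop) (by fun_prop) (.inr hs')

theorem IsSelfAdjoint.norm_mul_le_norm_mul_comm {E : Type*} [NormedRing E] [StarRing E]
    [CStarRing E] {u v : E} (h : IsSelfAdjoint (u * v)) : ‖u * v‖ ≤ ‖v * u‖ := by
  by_contra! hlt
  set a := ‖u * v‖
  set c := ‖v * u‖
  have hc : 0 ≤ c := norm_nonneg _
  have ha : 0 < a := hc.trans_lt hlt
  set K := ‖u‖ * ‖v‖ + 1
  have hK : 0 < K := by positivity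
  have hpow : ∀ n, (u * v) ^ (n + 1) = u * (v * u) ^ n * v := fun n => by
    induction n with
    | zero => simp
    | succ n ih => rw [pow_succ, ih, pow_succ]; simp only [mul_assoc]
  have hbound : ∀ n, 0 < n → ‖(u * v) ^ (n + 1)‖ ≤ K * c ^ n := fun n hn => by
    rw [hpow]
    calc _ ≤ ‖u‖ * ‖(v * u) ^ n‖ * ‖v‖ := norm_mul₃_le
      _ ≤ ‖u‖ * c ^ n * ‖v‖ := by gcongr; exact norm_pow_le' _ hn
      _ ≤ K * c ^ n := by
        have := pow_nonneg hc n
        simp only [K]; nlinarith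
  obtain ⟨k, hk⟩ := exists_pow_lt_of_lt_one (div_pos ha hK) ((div_lt_one ha).2 hlt)
  obtain ⟨n, hn⟩ : ∃ n, 2 ^ (k + 1) = n + 1 :=
    ⟨2 ^ (k + 1) - 1, by have := Nat.one_le_two_pow (n := k + 1); omega⟩
  have hkn : k < n := by have := (k + 1).lt_two_pow_self; omega
  have h1 := h.norm_pow_two_pow (k + 1)
  rw [hn] at h1
  have h2 : a ^ (n + 1) ≤ K * c ^ n := h1 ▸ hbound n (by omega)
  have h3 : (c / a) ^ n < a / K :=
    (pow_le_pow_of_le_one (by positivity) ((div_lt_one ha).2 hlt).le hkn.le).trans_lt hk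
  rw [div_pow, div_lt_div_iff₀ (by positivity) hK] at h3
  rw [pow_succ] at h2
  linarith

theorem IsClosed.Icc_zero_one_subset_of_add_div_two_mem {D : Set ℝ} (hD : IsClosed D)
    (h0 : 0 ∈ D) (h1 : 1 ∈ D) (hmid : ∀ s ∈ D, ∀ t ∈ D, (s + t) / 2 ∈ D) : Set.Icc 0 1 ⊆ D := by
  rintro s ⟨hs0, hs1⟩
  by_contra hs
  have ha := (hD.inter isClosed_Iic).csSup_mem (s := D ∩ Set.Iic s) ⟨0, h0, hs0⟩
    ⟨s, fun _ hx => hx.2⟩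
  have hb := (hD.inter isClosed_Ici).csInf_mem (s := D ∩ Set.Ici s) ⟨1, h1, hs1⟩
    ⟨s, fun _ hx => hx.2⟩
  set a := sSup (D ∩ Set.Iic s)
  set b := sInf (D ∩ Set.Ici s)
  have has : a < s := lt_of_le_of_ne ha.2 fun h => hs (h ▸ ha.1)
  have hsb : s < b := lt_of_le_of_ne hb.2 fun h => hs (h ▸ hb.1)
  have hm := hmid a ha.1 b hb.1
  rcases le_total ((a + b) / 2) s with h | h
  · have : (a + b) / 2 ≤ a := le_csSup ⟨s, fun _ hx => hx.2⟩ ⟨hm, h⟩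
    linarith
  · have : b ≤ (a + b) / 2 := csInf_le ⟨s, fun _ hx => hx.2⟩ ⟨hm, h⟩
    linarith

/-- **Cordes inequality.**  For positive bounded self-adjoint operators `A`, `B` on a
nontrivial real Hilbert space and `0 ≤ s ≤ 1`, one has `‖A^s B^s‖ ≤ ‖A B‖^s`. -/
theorem cordes_inequality
    {H : Type*} [NormedAddCommGroup H] [InnerProductSpace ℝ H] [CompleteSpace H]
    [Nontrivial H]
    (A B As Bs : H →L[ℝ] H) (hA : A.IsPositive) (hB : B.IsPositive)
    (s : ℝ) (hs0 : 0 ≤ s) (hs1 : s ≤ 1)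
    (hAs : IsPosPow A s As) (hBs : IsPosPow B s Bs) :
    ‖As ∘L Bs‖ ≤ ‖A ∘L B‖ ^ s := by
  obtain ⟨F, hF, hFadd, hFsa, hF0, hF1, hFc⟩ := hA.exists_rpow_family
  obtain ⟨G, hG, hGadd, hGsa, hG0, hG1, hGc⟩ := hB.exists_rpow_family
  rw [hF s hs0 As hAs, hG s hs0 Bs hBs]
  change ‖F s * G s‖ ≤ ‖A * B‖ ^ s
  set D : Set ℝ := {t | 0 ≤ t ∧ ‖F t * G t‖ ≤ ‖A * B‖ ^ t} with hD
  have hzero : (0 : ℝ) ∈ D := ⟨le_rfl, by simp [hF0, hG0]⟩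
  have hone : (1 : ℝ) ∈ D := ⟨zero_le_one, by simp [hF1, hG1]⟩
  have hclosed : IsClosed D := by
    refine isClosed_of_closure_subset fun t ht => ?_
    have ht0 : 0 ≤ t := closure_minimal (fun x hx => hx.1) isClosed_Ici ht
    rcases ht0.eq_or_lt with rfl | htpos
    · exact hzero
    obtain ⟨u, hu, hlim⟩ := mem_closure_iff_seq_limit.1 ht
    have hFt := (hFc.continuousAt (Ioi_mem_nhds htpos)).tendsto.comp hlim
    have hGt := (hGc.continuousAt (Ioi_mem_nhds htpos)).tendsto.comp hlim
    exact ⟨ht0, le_of_tendsto_of_tendsto (hFt.mul hGt).norm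
      (tendsto_const_nhds.rpow hlim (.inr htpos)) (.of_forall fun n => (hu n).2)⟩
  refine (hclosed.Icc_zero_one_subset_of_add_div_two_mem hzero hone ?_ ⟨hs0, hs1⟩).2
  rintro s ⟨hs, hsD⟩ t ⟨ht, htD⟩
  have hm : 0 ≤ (s + t) / 2 := by positivity
  refine ⟨hm, ?_⟩
  set m := (s + t) / 2 with hmdef
  have hFm : F m * F m = F s * F t := by
    rw [← hFadd m m hm hm, ← hFadd s t hs ht, hmdef, add_halves]
  have hGm : G m * G m = G t * G s := by
    rw [← hGadd m m hm hm, ← hGadd t s ht hs, hmdef, add_halves, add_comm]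
  have hS : star (F m * G m) * (F m * G m) = (G m * F s) * (F t * G m) := by
    rw [star_mul, (hFsa m).star_eq, (hGsa m).star_eq]
    simp only [mul_assoc]
    rw [← mul_assoc (F m), hFm, mul_assoc]
  have hcomm : ‖G s * F s‖ = ‖F s * G s‖ := by
    rw [← norm_star, star_mul, (hFsa s).star_eq, (hGsa s).star_eq]
  have hsq : ‖F m * G m‖ ^ 2 ≤ (‖A * B‖ ^ m) ^ 2 := by
    calc ‖F m * G m‖ ^ 2 = ‖(G m * F s) * (F t * G m)‖ := by
          rw [← hS, sq]; exact CStarRing.norm_star_mul_self.symm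
      _ ≤ ‖(F t * G m) * (G m * F s)‖ :=
          IsSelfAdjoint.norm_mul_le_norm_mul_comm (hS ▸ .star_mul_self _)
      _ = ‖(F t * G t) * (G s * F s)‖ := by
          rw [mul_assoc, ← mul_assoc (G m), hGm]; simp only [mul_assoc]
      _ ≤ ‖F t * G t‖ * ‖F s * G s‖ := hcomm ▸ norm_mul_le _ _
      _ ≤ ‖A * B‖ ^ t * ‖A * B‖ ^ s := by gcongr
      _ = (‖A * B‖ ^ m) ^ 2 := by
          rw [sq, ← Real.rpow_add_of_nonneg (norm_nonneg _) ht hs,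
            ← Real.rpow_add_of_nonneg (norm_nonneg _) hm hm, hmdef, add_halves, add_comm]
  exact le_of_sq_le_sq hsq (by positivity)
end

section
/- Let H be a nontrivial real Hilbert space, P : H → H an orthogonal projection (i.e. P is bounded, self-adjoint and P² = P), A a positive bounded self-adjoint operator on H, and 0 ≤ s ≤ 1. Then ‖P A^s‖ ≤ ‖P A‖^s. -/
open Filter

/-- Sandwiching a positive operator between two copies of a positive operator. -/
lemma ContinuousLinearMap.IsPositive.mul_mul_self {H : Type*} [NormedAddCommGroup H]
    [InnerProductSpace ℝ H] [CompleteSpace H] {S T : H →L[ℝ] H}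
    (hT : T.IsPositive) (hS : S.IsPositive) : (S * T * S).IsPositive := by
  have h := hT.conj_adjoint S
  rwa [hS.isSelfAdjoint.adjoint_eq] at h

lemma ContinuousLinearMap.IsPositive.pow_of_nat {H : Type*} [NormedAddCommGroup H]
    [InnerProductSpace ℝ H] [CompleteSpace H] {T : H →L[ℝ] H}
    (hT : T.IsPositive) (k : ℕ) : (T ^ k).IsPositive := by
  induction k using Nat.twoStepInduction with
  | zero => simp
  | one => simpa using hT
  | more k ih _ =>
    have h : T ^ (k + 2) = T * T ^ k * T := by rw [← pow_succ', ← pow_succ]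
    exact h ▸ ih.mul_mul_self hT

lemma ContinuousLinearMap.IsPositive.mul_one_sub {H : Type*} [NormedAddCommGroup H]
    [InnerProductSpace ℝ H] [CompleteSpace H] {T : H →L[ℝ] H}
    (hT : T.IsPositive) (hT' : (1 - T).IsPositive) : (T * (1 - T)).IsPositive := by
  have h : T * (1 - T) = T * (1 - T) * T + (1 - T) * T * (1 - T) := by noncomm_ring
  exact h ▸ (hT'.mul_mul_self hT).add (hT.mul_mul_self hT')

lemma ContinuousLinearMap.IsPositive.pow_mul_one_sub_pow {H : Type*} [NormedAddCommGroup H]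
    [InnerProductSpace ℝ H] [CompleteSpace H] {T : H →L[ℝ] H}
    (hT : T.IsPositive) (hT' : (1 - T).IsPositive) (k l : ℕ) :
    (T ^ k * (1 - T) ^ l).IsPositive := by
  have hc : Commute T (1 - T) := (Commute.one_right T).sub_right (Commute.refl T)
  induction k using Nat.twoStepInduction with
  | zero => simpa using hT'.pow_of_nat l
  | one =>
    induction l using Nat.twoStepInduction with
    | zero => simpa using hT
    | one => simpa using hT.mul_one_sub hT'
    | more l ih _ =>
      have h : T ^ 1 * (1 - T) ^ (l + 2) = (1 - T) * (T ^ 1 * (1 - T) ^ l) * (1 - T) := by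
        rw [← mul_assoc, ← (hc.pow_left 1).eq, mul_assoc, mul_assoc, ← pow_succ, ← pow_succ']
      exact h ▸ ih.mul_mul_self hT'
  | more k ih _ =>
    have h : T ^ (k + 2) * (1 - T) ^ l = T * (T ^ k * (1 - T) ^ l) * T := by
      rw [mul_assoc, mul_assoc, ← (hc.pow_right l).eq, ← mul_assoc, ← mul_assoc, ← pow_succ',
        ← pow_succ]
    exact h ▸ ih.mul_mul_self hT

lemma isPositive_aeval_bernsteinPolynomial {H : Type*} [NormedAddCommGroup H]
    [InnerProductSpace ℝ H] [CompleteSpace H] {T : H →L[ℝ] H}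
    (hT : T.IsPositive) (hT' : (1 - T).IsPositive) (n k : ℕ) :
    (Polynomial.aeval T (bernsteinPolynomial ℝ n k)).IsPositive := by
  have h : Polynomial.aeval T (bernsteinPolynomial ℝ n k)
      = (n.choose k : ℝ) • (T ^ k * (1 - T) ^ (n - k)) := by
    simp [bernsteinPolynomial, mul_assoc, Algebra.smul_def]
  exact h ▸ (hT.pow_mul_one_sub_pow hT' k (n - k)).smul_of_nonneg (Nat.cast_nonneg _)

/-- Jensen's inequality for the square and a finite positive-operator-valued measure. -/
lemma norm_sq_sum_smul_apply_le {H ι : Type*} [NormedAddCommGroup H]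
    [InnerProductSpace ℝ H] [CompleteSpace H] (t : Finset ι) (W : ι → H →L[ℝ] H)
    (hW : ∀ i ∈ t, (W i).IsPositive) (hsum : ∑ i ∈ t, W i = 1) (g : ι → ℝ) (x : H) :
    ‖(∑ i ∈ t, g i • W i) x‖ ^ 2 ≤ ∑ i ∈ t, g i ^ 2 * inner ℝ (W i x) x := by
  set y := (∑ i ∈ t, g i • W i) x
  have h1 : ∑ i ∈ t, inner ℝ (W i y) y = ‖y‖ ^ 2 := by
    rw [← sum_inner, ← sum_apply, hsum]
    simp
  have h2 : ∑ i ∈ t, g i * inner ℝ (W i x) y = ‖y‖ ^ 2 := by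
    have h : inner ℝ ((∑ i ∈ t, g i • W i) x) y = ‖y‖ ^ 2 := real_inner_self_eq_norm_sq y
    rw [← h, sum_apply, sum_inner]
    exact Finset.sum_congr rfl fun i _ => by rw [smul_apply, real_inner_smul_left]
  have h3 : 0 ≤ ∑ i ∈ t, (g i ^ 2 * inner ℝ (W i x) x - 2 * (g i * inner ℝ (W i x) y)
      + inner ℝ (W i y) y) := by
    refine Finset.sum_nonneg fun i hi => ?_
    have h := (hW i hi).inner_nonneg_left (g i • x - y)
    have hs : inner ℝ (W i y) x = inner ℝ (W i x) y := by
      rw [(hW i hi).inner_left_eq_inner_right, real_inner_comm]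
    simp only [map_sub, map_smul, inner_sub_left, inner_sub_right, real_inner_smul_left,
      real_inner_smul_right, hs] at h
    linarith
  rw [Finset.sum_add_distrib, Finset.sum_sub_distrib, ← Finset.mul_sum, h1, h2] at h3
  linarith

lemma bernsteinPolynomial_sum_sq_smul (n : ℕ) :
    ∑ k ∈ Finset.range (n + 1), (k ^ 2) • bernsteinPolynomial ℝ n k
      = (n * (n - 1)) • Polynomial.X ^ 2 + n • Polynomial.X := by
  rw [← bernsteinPolynomial.sum_mul_smul, ← bernsteinPolynomial.sum_smul,
    ← Finset.sum_add_distrib]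
  refine Finset.sum_congr rfl fun k _ => ?_
  rw [← add_smul]
  congr 1
  cases k <;> simp; ring

lemma sum_sq_mul_inner_aeval_bernsteinPolynomial {H : Type*} [NormedAddCommGroup H]
    [InnerProductSpace ℝ H] [CompleteSpace H] {T : H →L[ℝ] H} (hT : T.IsPositive) (n : ℕ)
    (hn : n ≠ 0) (x : H) :
    ∑ k ∈ Finset.range (n + 1),
        ((k : ℝ) / n) ^ 2 * inner ℝ (Polynomial.aeval T (bernsteinPolynomial ℝ n k) x) x
      = ‖T x‖ ^ 2 + (inner ℝ (T x) x - ‖T x‖ ^ 2) / n := by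
  have h := congrArg (fun p => inner ℝ (Polynomial.aeval T p x) x)
    (bernsteinPolynomial_sum_sq_smul n)
  have hsq : inner ℝ (T (T x)) x = ‖T x‖ ^ 2 := by
    rw [hT.inner_left_eq_inner_right, real_inner_self_eq_norm_sq]
  obtain ⟨m, rfl⟩ := Nat.exists_eq_succ_of_ne_zero hn
  simp only [← Nat.cast_smul_eq_nsmul ℝ, map_sum, map_add, map_smul, map_pow, Polynomial.aeval_X,
    sum_apply, sum_inner, add_apply, inner_add_left,
    smul_apply, real_inner_smul_left, pow_two T,
    mul_apply_eq_comp, hsq] at h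
  simp only [div_pow, div_mul_eq_mul_div, ← Finset.sum_div]
  push_cast at h ⊢
  rw [h]
  field_simp
  ring

/-- The Bernstein polynomials of `x ↦ x ^ s` on `[0, M]`. -/
noncomputable def rpowBernstein (M s : ℝ) (n : ℕ) : Polynomial ℝ :=
  ∑ k ∈ Finset.range (n + 1),
    (M * (k / n)) ^ s • (bernsteinPolynomial ℝ n k).comp (M⁻¹ • Polynomial.X)

lemma tendstoUniformlyOn_rpowBernstein {M s : ℝ} (hM : 0 < M) (hs : 0 ≤ s) :
    TendstoUniformlyOn (fun n x => (rpowBernstein M s n).eval x) (fun x : ℝ => x ^ s) atTop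
      (Set.Icc 0 M) := by
  let f : C(unitInterval, ℝ) :=
    ⟨fun t => (M * t) ^ s, (continuous_const.mul continuous_subtype_val).rpow_const
      fun _ => Or.inr hs⟩
  have h := ContinuousMap.tendsto_iff_tendstoUniformly.1 (bernsteinApproximation_uniform f)
  rw [Metric.tendstoUniformly_iff] at h
  rw [Metric.tendstoUniformlyOn_iff]
  intro ε hε
  filter_upwards [h ε hε] with n hn x hx
  have h01 : M⁻¹ * x ∈ unitInterval :=
    ⟨mul_nonneg (inv_nonneg.2 hM.le) hx.1, by rw [inv_mul_le_iff₀ hM, mul_one]; exact hx.2⟩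
  convert! hn ⟨M⁻¹ * x, h01⟩ using 2
  · simp [f, hM.ne']
  · simp [bernsteinApproximation.apply, rpowBernstein, Finset.sum_range, f, bernstein.z,
      bernstein_apply, bernsteinPolynomial, Polynomial.eval_finsetSum, mul_comm]

lemma isPositive_one_sub_of_norm_le_one {H : Type*} [NormedAddCommGroup H]
    [InnerProductSpace ℝ H] [CompleteSpace H] {T : H →L[ℝ] H} (hT : IsSelfAdjoint T)
    (h : ‖T‖ ≤ 1) : (1 - T).IsPositive := by
  refine (ContinuousLinearMap.isPositive_iff' _).2 ⟨(IsSelfAdjoint.one _).sub hT, fun x => ?_⟩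
  have h1 : inner ℝ (T x) x ≤ ‖T x‖ * ‖x‖ := real_inner_le_norm _ _
  have h2 : ‖T x‖ ≤ ‖x‖ := by simpa using T.le_of_opNorm_le h x
  have h3 := real_inner_self_eq_norm_sq x
  simp only [sub_apply, one_apply_eq_self, inner_sub_left]
  nlinarith [norm_nonneg x]

lemma IsPosPow.norm_sq_apply_le {H : Type*} [NormedAddCommGroup H] [InnerProductSpace ℝ H]
    [CompleteSpace H] {A As : H →L[ℝ] H} (hA : A.IsPositive) {s : ℝ} (hs : 0 ≤ s)
    (hAs : IsPosPow A s As) {a b : ℝ} (hab : ∀ u : ℝ, 0 ≤ u → (u ^ s) ^ 2 ≤ a * u ^ 2 + b)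
    (x : H) : ‖As x‖ ^ 2 ≤ a * ‖A x‖ ^ 2 + b * ‖x‖ ^ 2 := by
  set M : ℝ := ‖A‖ + 1
  have hM : 0 < M := by positivity
  set T : H →L[ℝ] H := M⁻¹ • A with hTdef
  have hT : T.IsPositive := hA.smul_of_nonneg (inv_nonneg.2 hM.le)
  have hT' : (1 - T).IsPositive := by
    refine isPositive_one_sub_of_norm_le_one hT.isSelfAdjoint ?_
    rw [norm_smul, norm_inv, Real.norm_of_nonneg hM.le, inv_mul_le_iff₀ hM]
    simp [M]
  have hMT : M * ‖T x‖ = ‖A x‖ := by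
    rw [hTdef, smul_apply, norm_smul, norm_inv, Real.norm_of_nonneg hM.le,
      mul_inv_cancel_left₀ hM.ne']
  have haeval (n : ℕ) : Polynomial.aeval A (rpowBernstein M s n)
      = ∑ k ∈ Finset.range (n + 1),
        (M * (k / n)) ^ s • Polynomial.aeval T (bernsteinPolynomial ℝ n k) := by
    simp [rpowBernstein, Polynomial.aeval_comp, T]
  have hlim : Tendsto (fun n => ‖Polynomial.aeval A (rpowBernstein M s n) x‖ ^ 2) atTop
      (nhds (‖As x‖ ^ 2)) := by
    have h := hAs _ ((tendstoUniformlyOn_rpowBernstein hM hs).mono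
      (Set.Icc_subset_Icc_right (by simp [M])))
    exact (((ContinuousLinearMap.apply ℝ H x).continuous.tendsto As).comp h).norm.pow 2
  have hlim' : Tendsto (fun n : ℕ => a * M ^ 2 *
      (‖T x‖ ^ 2 + (inner ℝ (T x) x - ‖T x‖ ^ 2) / n) + b * ‖x‖ ^ 2) atTop
      (nhds (a * M ^ 2 * (‖T x‖ ^ 2 + 0) + b * ‖x‖ ^ 2)) :=
    (((tendsto_const_div_atTop_nhds_zero_nat _).const_add _).const_mul _).add_const _
  have hle := le_of_tendsto_of_tendsto hlim hlim' ?_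
  · rw [← hMT]
    linarith
  filter_upwards [eventually_ne_atTop 0] with n hn
  have hsum : ∑ k ∈ Finset.range (n + 1), Polynomial.aeval T (bernsteinPolynomial ℝ n k) = 1 := by
    rw [← map_sum, bernsteinPolynomial.sum, map_one]
  have hpos (k : ℕ) := isPositive_aeval_bernsteinPolynomial hT hT' n k
  have hmass : ∑ k ∈ Finset.range (n + 1),
      inner ℝ (Polynomial.aeval T (bernsteinPolynomial ℝ n k) x) x = ‖x‖ ^ 2 := by
    rw [← sum_inner, ← sum_apply, hsum]
    simp
  calc ‖Polynomial.aeval A (rpowBernstein M s n) x‖ ^ 2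
      ≤ ∑ k ∈ Finset.range (n + 1), ((M * (k / n)) ^ s) ^ 2 *
          inner ℝ (Polynomial.aeval T (bernsteinPolynomial ℝ n k) x) x := by
        rw [haeval]
        exact norm_sq_sum_smul_apply_le _ _ (fun k _ => hpos k) hsum _ x
    _ ≤ ∑ k ∈ Finset.range (n + 1), (a * (M * (k / n)) ^ 2 + b) *
          inner ℝ (Polynomial.aeval T (bernsteinPolynomial ℝ n k) x) x :=
        Finset.sum_le_sum fun k _ => mul_le_mul_of_nonneg_right (hab _ (by positivity))
          ((hpos k).inner_nonneg_left x)
    _ = _ := by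
        rw [← sum_sq_mul_inner_aeval_bernsteinPolynomial hT n hn, ← hmass, Finset.mul_sum,
          Finset.mul_sum, ← Finset.sum_add_distrib]
        exact Finset.sum_congr rfl fun k _ => by ring

/-- The graph of `v ↦ v ^ s` lies below its tangent at `c`. -/
lemma rpow_le_tangent {s c v : ℝ} (hs0 : 0 ≤ s) (hs1 : s ≤ 1) (hc : 0 < c) (hv : 0 ≤ v) :
    v ^ s ≤ s * c ^ (s - 1) * v + (1 - s) * c ^ s := by
  have h := Real.geom_mean_le_arith_mean2_weighted hs0 (sub_nonneg.2 hs1) hv hc.le (by ring)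
  have h1 : c ^ (1 - s) * c ^ (s - 1) = 1 := by
    rw [← Real.rpow_add hc]; simp
  have h2 : c * c ^ (s - 1) = c ^ s := by
    rw [mul_comm, ← Real.rpow_add_one hc.ne', sub_add_cancel]
  have h3 := mul_le_mul_of_nonneg_right h (Real.rpow_nonneg hc.le (s - 1))
  rw [mul_assoc, h1, mul_one] at h3
  rw [← h2]
  linarith

lemma IsPosPow.norm_apply_le {H : Type*} [NormedAddCommGroup H] [InnerProductSpace ℝ H]
    [CompleteSpace H] {A As : H →L[ℝ] H} (hA : A.IsPositive) {s : ℝ} (hs0 : 0 ≤ s)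
    (hs1 : s ≤ 1) (hAs : IsPosPow A s As) {m : ℝ} (hm : 0 ≤ m) {x : H} (hx : ‖x‖ ≤ 1)
    (hAx : ‖A x‖ ≤ m) : ‖As x‖ ≤ m ^ s := by
  have key (c : ℝ) (hc : m ^ 2 < c) : ‖As x‖ ^ 2 ≤ c ^ s := by
    have hc0 : 0 < c := (sq_nonneg m).trans_lt hc
    have h := hAs.norm_sq_apply_le hA hs0 (a := s * c ^ (s - 1)) (b := (1 - s) * c ^ s)
      (fun u hu => by
        rw [Real.rpow_pow_comm hu]
        exact rpow_le_tangent hs0 hs1 hc0 (sq_nonneg u)) x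
    have h1 : ‖A x‖ ^ 2 ≤ c := (pow_le_pow_left₀ (norm_nonneg _) hAx 2).trans hc.le
    have h2 : ‖x‖ ^ 2 ≤ 1 := pow_le_one₀ (norm_nonneg _) hx
    have h3 : c ^ (s - 1) * c = c ^ s := by rw [← Real.rpow_add_one hc0.ne']; simp
    calc ‖As x‖ ^ 2 ≤ s * c ^ (s - 1) * ‖A x‖ ^ 2 + (1 - s) * c ^ s * ‖x‖ ^ 2 := h
      _ ≤ s * c ^ (s - 1) * c + (1 - s) * c ^ s * 1 := by
        have := sub_nonneg.2 hs1
        gcongr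
      _ = c ^ s := by rw [mul_assoc, h3]; ring
  have hlim : Tendsto (fun c : ℝ => c ^ s) (nhdsWithin (m ^ 2) (Set.Ioi (m ^ 2)))
      (nhds ((m ^ 2) ^ s)) :=
    (Real.continuousAt_rpow_const _ _ (Or.inr hs0)).tendsto.mono_left nhdsWithin_le_nhds
  have h := ge_of_tendsto hlim (eventually_nhdsWithin_of_forall key)
  rw [← Real.rpow_pow_comm hm] at h
  exact le_of_sq_le_sq h (Real.rpow_nonneg hm s)

lemma IsPosPow.isSelfAdjoint {H : Type*} [NormedAddCommGroup H] [InnerProductSpace ℝ H]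
    [CompleteSpace H] {A As : H →L[ℝ] H} (hA : IsSelfAdjoint A) {s : ℝ} (hs : 0 ≤ s)
    (hAs : IsPosPow A s As) : IsSelfAdjoint As := by
  have h := hAs _ ((tendstoUniformlyOn_rpowBernstein (M := ‖A‖ + 1) (by positivity) hs).mono
      (Set.Icc_subset_Icc_right (by simp)))
  have hcl : IsClosed {B : H →L[ℝ] H | IsSelfAdjoint B} :=
    isClosed_eq continuous_star continuous_id
  refine hcl.mem_of_tendsto h (Eventually.of_forall fun n => ?_)
  rw [Set.mem_ofPred_eq, Polynomial.aeval_eq_sum_range]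
  exact isSelfAdjoint_sum _ fun i _ => (IsSelfAdjoint.all _).smul (hA.pow i)

/-- **Projection–power norm bound.**  For an orthogonal projection `P` (bounded,
self-adjoint, idempotent), a positive operator `A` on a nontrivial real Hilbert space
and `0 ≤ s ≤ 1`, one has `‖P A^s‖ ≤ ‖P A‖^s`. -/
theorem projection_power_norm_bound
    {H : Type*} [NormedAddCommGroup H] [InnerProductSpace ℝ H] [CompleteSpace H]
    [Nontrivial H]
    (P A As : H →L[ℝ] H) (hPsa : IsSelfAdjoint P) (hPP : P ∘L P = P)
    (hA : A.IsPositive) (s : ℝ) (hs0 : 0 ≤ s) (hs1 : s ≤ 1)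
    (hAs : IsPosPow A s As) :
    ‖P ∘L As‖ ≤ ‖P ∘L A‖ ^ s := by
  rw [← norm_star (P ∘L As), ← norm_star (P ∘L A)]
  have hstar {B : H →L[ℝ] H} (hB : IsSelfAdjoint B) : star (P ∘L B) = B ∘L P := by
    change star (P * B) = B * P
    rw [star_mul, hB.star_eq, hPsa.star_eq]
  rw [hstar hA.isSelfAdjoint, hstar (hAs.isSelfAdjoint hA.isSelfAdjoint hs0)]
  have hP : ‖P‖ ≤ 1 := IsStarProjection.norm_le P ⟨hPP, hPsa⟩
  refine ContinuousLinearMap.opNorm_le_of_unit_norm (by positivity) fun x hx => ?_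
  have hPx : ‖P x‖ ≤ 1 := by simpa [hx] using P.le_of_opNorm_le hP x
  refine hAs.norm_apply_le hA hs0 hs1 (norm_nonneg _) hPx ?_
  have h := (A ∘L P).le_opNorm (x)
  simpa [hx] using h
end

section
/- Let H be a real Hilbert space, Σ̂ a positive bounded self-adjoint operator on H, λ > 0, and write Σ̂_λ = Σ̂ + λI. Let E be a finite-dimensional real inner product space and V : E → H a bounded linear map with V*V = I_E. Then V*Σ̂_λV is invertible and, setting W := V (V*Σ̂_λV)^{−1} V*, the following operator identity holds: I − W Σ̂ = (I − VV*) + λ W − W Σ̂_λ (I − VV*). -/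
open ContinuousLinearMap in
/-- The compression of `S + c I`, with `S` positive and `c > 0`, by an isometry is invertible. -/
theorem ContinuousLinearMap.IsPositive.isUnit_adjoint_comp_add_smul_one_comp
    {H E : Type*} [NormedAddCommGroup H] [InnerProductSpace ℝ H] [CompleteSpace H]
    [NormedAddCommGroup E] [InnerProductSpace ℝ E] [CompleteSpace E]
    {S : H →L[ℝ] H} (hS : S.IsPositive) {c : ℝ} (hc : 0 < c)
    {V : E →L[ℝ] H} (hV : V.adjoint ∘L V = 1) :
    IsUnit (V.adjoint ∘L (S + c • (1 : H →L[ℝ] H)) ∘L V) := by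
  refine isUnit_of_forall_le_norm_inner_map _ (c := ⟨c, hc.le⟩) hc fun x ↦ ?_
  have hnorm : inner ℝ (V x) (V x) = ‖x‖ ^ 2 := by
    rw [← adjoint_inner_left, ← comp_apply, hV, one_apply_eq_self, real_inner_self_eq_norm_sq]
  have hinner : inner ℝ ((V.adjoint ∘L (S + c • (1 : H →L[ℝ] H)) ∘L V) x) x =
      inner ℝ (S (V x)) (V x) + c * ‖x‖ ^ 2 := by
    simp [adjoint_inner_left, inner_add_left, inner_smul_left, ← hnorm]
  rw [hinner, Real.norm_eq_abs]
  refine le_trans ?_ (le_abs_self _)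
  have hpos := hS.inner_nonneg_left (V x)
  change ‖x‖ ^ 2 * c ≤ _
  linarith


/-- **Key algebraic decomposition for the approximation term.**
For a positive operator `Σ̂` on `H`, `λ > 0`, `Σ̂_λ = Σ̂ + λI`, and `V : E → H` a bounded
map from a finite-dimensional inner product space with `V*V = I`, the operator `V*Σ̂_λV`
is invertible and, with `W = V (V*Σ̂_λV)⁻¹ V*`,
`I − W Σ̂ = (I − VV*) + λ W − W Σ̂_λ (I − VV*)`. -/
theorem nystrom_decomposition_identity
    {H E : Type*} [NormedAddCommGroup H] [InnerProductSpace ℝ H] [CompleteSpace H]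
    [NormedAddCommGroup E] [InnerProductSpace ℝ E] [FiniteDimensional ℝ E]
    (Shat : H →L[ℝ] H) (hS : Shat.IsPositive) (lam : ℝ) (hlam : 0 < lam)
    (V : E →L[ℝ] H) (hV : V.adjoint ∘L V = 1) :
    IsUnit (V.adjoint ∘L (Shat + lam • (1 : H →L[ℝ] H)) ∘L V) ∧
      ∀ W : H →L[ℝ] H,
        W = V ∘L Ring.inverse (V.adjoint ∘L (Shat + lam • (1 : H →L[ℝ] H)) ∘L V) ∘L
              V.adjoint →
        1 - W ∘L Shat =
          (1 - V ∘L V.adjoint) + lam • W -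
            W ∘L (Shat + lam • (1 : H →L[ℝ] H)) ∘L (1 - V ∘L V.adjoint) := by
  have hunit := hS.isUnit_adjoint_comp_add_smul_one_comp hlam hV
  refine ⟨hunit, fun W hW ↦ ?_⟩
  have hproj : W ∘L (Shat + lam • (1 : H →L[ℝ] H)) ∘L V ∘L V.adjoint = V ∘L V.adjoint := by
    have hinv := congrArg (fun T : E →L[ℝ] E ↦ V ∘L T ∘L V.adjoint)
      (Ring.inverse_mul_cancel _ hunit)
    rw [hW]
    exact hinv
  rw [ContinuousLinearMap.comp_sub, ContinuousLinearMap.comp_sub, hproj]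
  ext x
  simp
  abel
end
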